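/- Let λ ∈ ℂ, and let f, g be functions holomorphic on ℂ∖L that extend to meromorphic functions on ℂ with poles contained in L, satisfying f(z+1) = f(z), f(z+τ) = e^{−2iπλ} f(z), g(z+1) = g(z) and g(z+τ) = e^{2iπλ} g(z) for all z ∈ ℂ∖L. Then for every r with 0 < r < dist(0, L∖{0}), the contour integral over the positively oriented circle of radius r centered at 0 vanishes: ∮_{|ζ|=r} f(ζ) g(ζ) dζ = 0. (This expresses that the residue pairing ⟨f,g⟩ = res₀(f g dz) vanishes on L_λ × L_{−λ}, i.e., the subspaces L_λ and L_{−λ} annihilate each other, and in particular the subspaces 𝔤_λ of the paper are isotropic.) -/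

import Mathlib

noncomputable section
open Complex Matrix Kronecker

/-- The lattice `L = ℤ + τℤ`. -/
def LatSet (τ : ℂ) : Set ℂ := {z | ∃ m n : ℤ, z = (m : ℂ) + (n : ℂ) * τ}

/-- `θ` is the theta function of the paper: entire, `θ′(0) = 1`, zero set exactly `L`,
`θ(z+1) = −θ(z)` and `θ(z+τ) = −e^{−iπτ} e^{−2iπz} θ(z)`. -/
def IsTheta (τ : ℂ) (θ : ℂ → ℂ) : Prop :=
  Differentiable ℂ θ ∧ deriv θ 0 = 1 ∧ (∀ z, θ z = 0 ↔ z ∈ LatSet τ) ∧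
    (∀ z, θ (z + 1) = -θ z) ∧
    (∀ z, θ (z + τ) = -Complex.exp (-((Real.pi : ℂ) * Complex.I * τ)) *
      Complex.exp (-(2 * (Real.pi : ℂ) * Complex.I * z)) * θ z)

/-- Boundary integral over the rectangle `[-a,a] × [-b,b]`. -/
def rectInt (a b : ℝ) (F : ℂ → ℂ) : ℂ :=
  (∫ x : ℝ in (-a)..a, F (x + ((-b : ℝ) : ℂ) * I)) - (∫ x : ℝ in (-a)..a, F (x + (b : ℂ) * I)) +
    I * (∫ y : ℝ in (-b)..b, F ((a : ℂ) + y * I)) -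
    I * (∫ y : ℝ in (-b)..b, F (((-a : ℝ) : ℂ) + y * I))

/-- Boundary of the rectangle. -/
def rectBd (a b : ℝ) : Set ℂ :=
  {z | (|z.re| = a ∧ |z.im| ≤ b) ∨ (|z.re| ≤ a ∧ |z.im| = b)}

lemma rect_side_h {a b : ℝ} (ha : 0 < a) (c : ℝ) (hc : |c| = b) (x : ℝ)
    (hx : x ∈ Set.uIcc (-a) a) : ((x : ℂ) + (c : ℂ) * I) ∈ rectBd a b := by
  rw [Set.uIcc_of_le (by linarith)] at hx
  right
  simpa [hc, abs_le] using hx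

lemma rect_side_v {a b : ℝ} (hb : 0 < b) (c : ℝ) (hc : |c| = a) (x : ℝ)
    (hx : x ∈ Set.uIcc (-b) b) : ((c : ℂ) + (x : ℂ) * I) ∈ rectBd a b := by
  rw [Set.uIcc_of_le (by linarith)] at hx
  left
  simpa [hc, abs_le] using hx

lemma rectInt_congr {a b : ℝ} (ha : 0 < a) (hb : 0 < b) {F G : ℂ → ℂ}
    (h : Set.EqOn F G (rectBd a b)) : rectInt a b F = rectInt a b G := by
  unfold rectInt
  congr 1
  · congr 1
    · congr 1
      · exact intervalIntegral.integral_congr fun x hx =>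
          h (rect_side_h ha _ (by rw [abs_neg, abs_of_pos hb]) x hx)
      · exact intervalIntegral.integral_congr fun x hx =>
          h (rect_side_h ha _ (abs_of_pos hb) x hx)
    · congr 1
      exact intervalIntegral.integral_congr fun x hx =>
          h (rect_side_v hb _ (abs_of_pos ha) x hx)
  · congr 1
    exact intervalIntegral.integral_congr fun x hx =>
          h (rect_side_v hb _ (by rw [abs_neg, abs_of_pos ha]) x hx)

lemma rect_ii_h {a b : ℝ} (ha : 0 < a) {F : ℂ → ℂ} (hF : ContinuousOn F (rectBd a b))
    (c : ℝ) (hc : |c| = b) :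
    IntervalIntegrable (fun x : ℝ => F (x + (c : ℂ) * I)) MeasureTheory.volume (-a) a := by
  apply ContinuousOn.intervalIntegrable
  exact hF.comp (by fun_prop) (fun x hx => rect_side_h ha c hc x hx)

lemma rect_ii_v {a b : ℝ} (hb : 0 < b) {F : ℂ → ℂ} (hF : ContinuousOn F (rectBd a b))
    (c : ℝ) (hc : |c| = a) :
    IntervalIntegrable (fun x : ℝ => F ((c : ℂ) + x * I)) MeasureTheory.volume (-b) b := by
  apply ContinuousOn.intervalIntegrable
  exact hF.comp (by fun_prop) (fun x hx => rect_side_v hb c hc x hx)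

lemma rectInt_add {a b : ℝ} (ha : 0 < a) (hb : 0 < b) {F G : ℂ → ℂ}
    (hF : ContinuousOn F (rectBd a b)) (hG : ContinuousOn G (rectBd a b)) :
    rectInt a b (fun z => F z + G z) = rectInt a b F + rectInt a b G := by
  unfold rectInt
  have e1 : |(-b)| = b := by rw [abs_neg, abs_of_pos hb]
  have e2 : |b| = b := abs_of_pos hb
  have e3 : |(-a)| = a := by rw [abs_neg, abs_of_pos ha]
  have e4 : |a| = a := abs_of_pos ha
  rw [intervalIntegral.integral_add (rect_ii_h ha hF _ e1) (rect_ii_h ha hG _ e1),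
    intervalIntegral.integral_add (rect_ii_h ha hF _ e2) (rect_ii_h ha hG _ e2),
    intervalIntegral.integral_add (rect_ii_v hb hF _ e3) (rect_ii_v hb hG _ e3),
    intervalIntegral.integral_add (rect_ii_v hb hF _ e4) (rect_ii_v hb hG _ e4)]
  ring

lemma rectInt_const_mul (a b : ℝ) (c : ℂ) (F : ℂ → ℂ) :
    rectInt a b (fun z => c * F z) = c * rectInt a b F := by
  unfold rectInt
  simp only [intervalIntegral.integral_const_mul]
  ring

lemma rectInt_holo {a b : ℝ} (ha : 0 < a) (hb : 0 < b) {F : ℂ → ℂ}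
    (hF : DifferentiableOn ℂ F {z | |z.re| ≤ a ∧ |z.im| ≤ b}) : rectInt a b F = 0 := by
  have := integral_boundary_rect_eq_zero_of_differentiableOn F ⟨-a, -b⟩ ⟨a, b⟩ (hF.mono ?_)
  · simpa [rectInt] using this
  · intro z hz
    rw [mem_reProdIm, Set.uIcc_of_le (by simp; linarith), Set.uIcc_of_le (by simp; linarith)] at hz
    simpa [abs_le] using hz

lemma rectBd_ne_zero {a b : ℝ} (ha : 0 < a) (hb : 0 < b) {z : ℂ} (hz : z ∈ rectBd a b) :
    z ≠ 0 := by
  rintro rfl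
  rcases hz with h | h <;> simp at h <;> linarith

/-- Integral of a derivative around the rectangle. -/
lemma rectInt_deriv {a b : ℝ} (ha : 0 < a) (hb : 0 < b) {Q F : ℂ → ℂ}
    (hF : ContinuousOn F (rectBd a b)) (hQ : ∀ z ∈ rectBd a b, HasDerivAt Q (F z) z) :
    rectInt a b F = 0 := by
  have e1 : |(-b)| = b := by rw [abs_neg, abs_of_pos hb]
  have e2 : |b| = b := abs_of_pos hb
  have e3 : |(-a)| = a := by rw [abs_neg, abs_of_pos ha]
  have e4 : |a| = a := abs_of_pos ha
  have H : ∀ c : ℝ, |c| = b → ∫ x : ℝ in (-a)..a, F (x + (c : ℂ) * I)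
      = Q ((a : ℝ) + (c : ℂ) * I) - Q ((-a : ℝ) + (c : ℂ) * I) := by
    intro c hc
    refine intervalIntegral.integral_eq_sub_of_hasDerivAt
      (f := fun x : ℝ => Q ((x : ℂ) + (c : ℂ) * I)) (fun x hx => ?_) (rect_ii_h ha hF c hc)
    have h1 : HasDerivAt (fun x : ℝ => (x : ℂ) + (c : ℂ) * I) 1 x :=
      (HasDerivAt.ofReal_comp (hasDerivAt_id x)).add_const _ |>.congr_deriv (by simp)
    exact ((hQ _ (rect_side_h ha c hc x hx)).comp x h1).congr_deriv (by simp)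
  have V : ∀ c : ℝ, |c| = a → I * ∫ x : ℝ in (-b)..b, F ((c : ℂ) + x * I)
      = Q ((c : ℂ) + (b : ℝ) * I) - Q ((c : ℂ) + (-b : ℝ) * I) := by
    intro c hc
    rw [← intervalIntegral.integral_const_mul]
    refine intervalIntegral.integral_eq_sub_of_hasDerivAt
      (f := fun x : ℝ => Q ((c : ℂ) + (x : ℂ) * I)) (fun x hx => ?_)
      ((rect_ii_v hb hF c hc).const_mul _)
    have h1 : HasDerivAt (fun x : ℝ => (c : ℂ) + (x : ℂ) * I) I x :=
      ((HasDerivAt.ofReal_comp (hasDerivAt_id x)).mul_const I).const_add _ |>.congr_deriv (by simp)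
    exact ((hQ _ (rect_side_v hb c hc x hx)).comp x h1).congr_deriv (by ring)
  unfold rectInt
  rw [H _ e1, H _ e2, V _ e3, V _ e4]
  ring

lemma rectInt_inv_ne_zero {a b : ℝ} (ha : 0 < a) (hb : 0 < b) :
    rectInt a b (fun z => z⁻¹) ≠ 0 := by
  have hF : ContinuousOn (fun z : ℂ => z⁻¹) (rectBd a b) :=
    continuousOn_inv₀.mono fun z hz => rectBd_ne_zero ha hb hz
  have e1 : |(-b)| = b := by rw [abs_neg, abs_of_pos hb]
  have e2 : |b| = b := abs_of_pos hb
  have e3 : |(-a)| = a := by rw [abs_neg, abs_of_pos ha]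
  have e4 : |a| = a := abs_of_pos ha
  have key : ∀ p q : ℝ, 0 < p → 0 < q → 0 < ∫ x : ℝ in (-q)..q, 2 * p / (x ^ 2 + p ^ 2) := by
    intro p q hp hq
    refine intervalIntegral.intervalIntegral_pos_of_pos ?_ (fun x => by positivity) (by linarith)
    apply Continuous.intervalIntegrable
    exact continuous_const.div (by fun_prop) (fun x => by positivity)
  have h1 : (∫ x : ℝ in (-a)..a, ((x : ℂ) + ((-b : ℝ) : ℂ) * I)⁻¹) -
      (∫ x : ℝ in (-a)..a, ((x : ℂ) + (b : ℂ) * I)⁻¹) =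
      I * ((∫ x : ℝ in (-a)..a, 2 * b / (x ^ 2 + b ^ 2) : ℝ) : ℂ) := by
    rw [← intervalIntegral.integral_sub (rect_ii_h ha hF _ e1) (rect_ii_h ha hF _ e2),
      ← intervalIntegral.integral_ofReal, ← intervalIntegral.integral_const_mul]
    refine intervalIntegral.integral_congr fun x hx => ?_
    have n1 := rectBd_ne_zero ha hb (rect_side_h ha _ e1 x hx)
    have n2 := rectBd_ne_zero ha hb (rect_side_h ha _ e2 x hx)
    have n3 : ((x : ℂ) ^ 2 + (b : ℂ) ^ 2) ≠ 0 := by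
      have : (x ^ 2 + b ^ 2 : ℝ) ≠ 0 := by positivity
      exact_mod_cast this
    push_cast at n1 ⊢
    have : ((x : ℂ) ^ 2 + (b : ℂ) ^ 2) = (x + -b * I) * (x + b * I) := by
      ring_nf; simp
    rw [this] at n3 ⊢
    simp only [neg_mul, ← sub_eq_add_neg] at n1 n3 ⊢
    field_simp
    ring
  have h2 : (∫ y : ℝ in (-b)..b, ((a : ℂ) + (y : ℂ) * I)⁻¹) -
      (∫ y : ℝ in (-b)..b, (((-a : ℝ) : ℂ) + (y : ℂ) * I)⁻¹) =
      ((∫ x : ℝ in (-b)..b, 2 * a / (x ^ 2 + a ^ 2) : ℝ) : ℂ) := by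
    rw [← intervalIntegral.integral_sub (rect_ii_v hb hF _ e4) (rect_ii_v hb hF _ e3),
      ← intervalIntegral.integral_ofReal]
    refine intervalIntegral.integral_congr fun x hx => ?_
    have n1 := rectBd_ne_zero ha hb (rect_side_v hb _ e3 x hx)
    have n2 := rectBd_ne_zero ha hb (rect_side_v hb _ e4 x hx)
    have n3 : ((x : ℂ) ^ 2 + (a : ℂ) ^ 2) ≠ 0 := by
      have : (x ^ 2 + a ^ 2 : ℝ) ≠ 0 := by positivity
      exact_mod_cast this
    push_cast at n1 ⊢
    have : ((x : ℂ) ^ 2 + (a : ℂ) ^ 2) = -((a + x * I) * (-a + x * I)) := by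
      ring_nf; simp
    rw [this] at n3 ⊢
    field_simp
    ring
  have h3 : rectInt a b (fun z => z⁻¹) =
      I * (((∫ x : ℝ in (-a)..a, 2 * b / (x ^ 2 + b ^ 2)) +
        (∫ x : ℝ in (-b)..b, 2 * a / (x ^ 2 + a ^ 2)) : ℝ) : ℂ) := by
    unfold rectInt
    rw [h1, add_sub_assoc, ← mul_sub, h2]
    push_cast
    ring
  rw [h3]
  have := add_pos (key b a hb ha) (key a b ha hb)
  exact mul_ne_zero I_ne_zero (by exact_mod_cast ne_of_gt this)

/-- Rectangle versus circle for functions with a pole at `0`. -/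
lemma rect_circle {a b r : ℝ} (ha : 0 < a) (hb : 0 < b) (hr : 0 < r) {U : Set ℂ}
    (hU : IsOpen U) (hUr : {z : ℂ | |z.re| ≤ a ∧ |z.im| ≤ b} ⊆ U)
    (hUc : Metric.closedBall 0 r ⊆ U) (N : ℕ) :
    ∀ u : ℂ → ℂ, DifferentiableOn ℂ u U →
      2 * Real.pi * I * rectInt a b (fun z => u z * (z ^ N)⁻¹) =
        rectInt a b (fun z => z⁻¹) * ∮ z in C(0, r), u z * (z ^ N)⁻¹ := by
  have hbd : rectBd a b ⊆ U := by
    refine Set.Subset.trans ?_ hUr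
    rintro z (h | h)
    · exact ⟨h.1.le, h.2⟩
    · exact ⟨h.1, h.2.le⟩
  have h0 : (0 : ℂ) ∈ U := hUc (by simp [hr.le])
  have hsph : Metric.sphere (0 : ℂ) r ⊆ U := Metric.sphere_subset_closedBall.trans hUc
  have hs0 : ∀ z ∈ Metric.sphere (0 : ℂ) r, z ≠ 0 := by
    rintro z hz rfl
    simp at hz; linarith
  have cont : ∀ (n : ℕ) (s : Set ℂ), (∀ z ∈ s, z ≠ 0) →
      ContinuousOn (fun z : ℂ => (z ^ n)⁻¹) s := fun n s hs =>
    ContinuousOn.inv₀ (by fun_prop) fun z hz => pow_ne_zero _ (hs z hz)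
  induction N with
  | zero =>
    intro u hu
    simp only [pow_zero, inv_one, mul_one]
    rw [rectInt_holo ha hb (hu.mono hUr),
      circleIntegral_eq_zero_of_differentiable_on_off_countable hr.le Set.countable_empty
        (hu.continuousOn.mono hUc) (fun z hz => hu.differentiableAt
          (hU.mem_nhds (hUc (Metric.ball_subset_closedBall hz.1))))]
    simp
  | succ N ih =>
    intro u hu
    have hd : DifferentiableOn ℂ (dslope u 0) U :=
      (Complex.differentiableOn_dslope (hU.mem_nhds h0)).2 hu
    have ih' := ih _ hd
    have dec : ∀ z : ℂ, z ≠ 0 → u z * (z ^ (N + 1))⁻¹ =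
        u 0 * (z ^ (N + 1))⁻¹ + dslope u 0 z * (z ^ N)⁻¹ := by
      intro z hz
      have := sub_smul_dslope u 0 z
      rw [sub_zero, smul_eq_mul] at this
      rw [show u z = u 0 + z * dslope u 0 z by rw [this]; ring]
      field_simp
      ring
    have base : 2 * Real.pi * I * rectInt a b (fun z => (z ^ (N + 1))⁻¹) =
        rectInt a b (fun z => z⁻¹) * ∮ z in C(0, r), (z ^ (N + 1))⁻¹ := by
      rcases Nat.eq_zero_or_pos N with rfl | hN
      · have := circleIntegral.integral_sub_center_inv (0 : ℂ) hr.ne'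
        simp only [sub_zero] at this
        simp only [zero_add, pow_one, this]
        ring
      · have h1 : (∮ z in C(0, r), (z ^ (N + 1))⁻¹ : ℂ) = 0 := by
          have := circleIntegral.integral_sub_zpow_of_ne (n := -((N + 1 : ℕ) : ℤ))
            (by omega) 0 0 r
          simpa only [sub_zero, _root_.zpow_neg, zpow_natCast] using this
        have h2 : rectInt a b (fun z => (z ^ (N + 1))⁻¹) = 0 := by
          refine rectInt_deriv ha hb (Q := fun z => -(N : ℂ)⁻¹ * (z ^ N)⁻¹)
            (cont _ _ fun z hz => rectBd_ne_zero ha hb hz) fun z hz => ?_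
          have hz0 := rectBd_ne_zero ha hb hz
          have hNC : (N : ℂ) ≠ 0 := by exact_mod_cast hN.ne'
          refine (((hasDerivAt_pow N z).fun_inv (pow_ne_zero _ hz0)).const_mul _).congr_deriv ?_
          obtain ⟨k, rfl⟩ : ∃ k, N = k + 1 := ⟨N - 1, by omega⟩
          simp only [Nat.add_sub_cancel]
          field_simp
          ring
        rw [h1, h2]; simp
    rw [rectInt_congr ha hb (fun z hz => dec z (rectBd_ne_zero ha hb hz)),
      circleIntegral.integral_congr hr.le (fun z hz => dec z (hs0 z hz)),
      rectInt_add ha hb, circleIntegral.integral_add, rectInt_const_mul,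
      circleIntegral.integral_const_mul]
    · linear_combination u 0 * base + ih'
    · exact (continuousOn_const.mul (cont _ _ hs0)).circleIntegrable hr.le
    · exact ((hd.continuousOn.mono hsph).mul (cont _ _ hs0)).circleIntegrable hr.le
    · exact continuousOn_const.mul (cont _ _ fun z hz => rectBd_ne_zero ha hb hz)
    · exact (hd.continuousOn.mono hbd).mul (cont _ _ fun z hz => rectBd_ne_zero ha hb hz)

lemma latSet_isClosed {τ : ℂ} (hτ : 0 < τ.im) : IsClosed (LatSet τ) := by
  have h : LatSet τ = (fun z : ℂ => z.im / τ.im) ⁻¹' (Set.range ((↑) : ℤ → ℝ)) ∩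
      (fun z : ℂ => z.re - z.im / τ.im * τ.re) ⁻¹' (Set.range ((↑) : ℤ → ℝ)) := by
    ext z
    simp only [LatSet, Set.mem_ofPred_eq, Set.mem_inter_iff, Set.mem_preimage, Set.mem_range]
    constructor
    · rintro ⟨m, n, rfl⟩
      refine ⟨⟨n, ?_⟩, ⟨m, ?_⟩⟩
      · simp [hτ.ne']
      · simp [hτ.ne']
    · rintro ⟨⟨n, hn⟩, ⟨m, hm⟩⟩
      refine ⟨m, n, ?_⟩
      rw [← hn] at hm
      rw [eq_div_iff hτ.ne'] at hn
      apply Complex.ext <;> simp <;> linarith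
  rw [h]
  have hc := Int.isClosedEmbedding_coe_real.isClosed_range
  exact (hc.preimage (by fun_prop)).inter (hc.preimage (by fun_prop))

/-- The residue pairing `⟨f,g⟩ = res₀(fg dz)` vanishes on `L_λ × L_{−λ}`: for `f` and `g`
holomorphic on `ℂ∖L`, meromorphic on `ℂ` with poles in `L`, and quasi-periodic with
opposite multipliers `e^{∓2iπλ}`, the contour integral of `fg` around `0` vanishes. -/
theorem residue_pairing_vanishes
    (τ : ℂ) (hτ : 0 < τ.im) (lam : ℂ)
    (f g : ℂ → ℂ)
    (hf1 : DifferentiableOn ℂ f (LatSet τ)ᶜ) (hf2 : MeromorphicOn f Set.univ)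
    (hg1 : DifferentiableOn ℂ g (LatSet τ)ᶜ) (hg2 : MeromorphicOn g Set.univ)
    (hfp1 : ∀ z ∉ LatSet τ, f (z + 1) = f z)
    (hfp2 : ∀ z ∉ LatSet τ,
      f (z + τ) = Complex.exp (-(2 * (Real.pi : ℂ) * Complex.I * lam)) * f z)
    (hgp1 : ∀ z ∉ LatSet τ, g (z + 1) = g z)
    (hgp2 : ∀ z ∉ LatSet τ,
      g (z + τ) = Complex.exp (2 * (Real.pi : ℂ) * Complex.I * lam) * g z)
    (r : ℝ) (hr0 : 0 < r) (hr : r < Metric.infDist (0 : ℂ) (LatSet τ \ {0})) :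
    (∮ ζ in C(0, r), f ζ * g ζ) = 0 := by
  set h : ℂ → ℂ := fun z => f z * g z with hh
  have hp1 : ∀ z ∉ LatSet τ, h (z + 1) = h z := fun z hz => by
    simp only [hh, hfp1 z hz, hgp1 z hz]
  have hp2 : ∀ z ∉ LatSet τ, h (z + τ) = h z := fun z hz => by
    simp only [hh, hfp2 z hz, hgp2 z hz]
    have : Complex.exp (-(2 * (Real.pi : ℂ) * Complex.I * lam)) *
        Complex.exp (2 * (Real.pi : ℂ) * Complex.I * lam) = 1 := by
      rw [← Complex.exp_add]; simp
    linear_combination f z * g z * this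
  have hd : DifferentiableOn ℂ h (LatSet τ)ᶜ := hf1.mul hg1
  obtain ⟨N, hN⟩ : MeromorphicAt h 0 := (hf2 0 trivial).mul (hg2 0 trivial)
  have hL := latSet_isClosed hτ
  set b : ℝ := τ.im / 2 with hbdef
  have hb : 0 < b := by positivity
  have ha : (0 : ℝ) < 1 / 2 := by norm_num
  set D := Metric.infDist (0 : ℂ) (LatSet τ \ {0}) with hD
  set U : Set ℂ := (LatSet τ)ᶜ ∪ Metric.ball 0 D with hUdef
  have hU : IsOpen U := hL.isOpen_compl.union Metric.isOpen_ball
  have hU0 : ∀ z ∈ U, z ≠ 0 → z ∉ LatSet τ := by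
    rintro z (hz | hz) h0 hzL
    · exact hz hzL
    · have := Metric.infDist_le_dist_of_mem (x := (0 : ℂ)) (s := LatSet τ \ {0}) ⟨hzL, h0⟩
      rw [Metric.mem_ball, dist_comm] at hz
      linarith
  have hUc : Metric.closedBall 0 r ⊆ U := fun z hz => Or.inr (by
    rw [Metric.mem_closedBall] at hz
    rw [Metric.mem_ball]
    linarith)
  have hrect : ∀ z : ℂ, |z.re| ≤ 1 / 2 → |z.im| ≤ b → z ∈ LatSet τ → z = 0 := by
    rintro z h1 h2 ⟨m, n, rfl⟩
    have hn : n = 0 := by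
      simp only [add_im, intCast_im, mul_im, intCast_re, zero_mul, zero_add, add_zero,
        abs_mul, abs_of_pos hτ] at h2
      have : |(n : ℝ)| < 1 := by
        by_contra hcon
        push Not at hcon
        nlinarith
      have : |n| < 1 := by exact_mod_cast this
      exact Int.abs_lt_one_iff.1 this
    subst hn
    have hm : m = 0 := by
      simp at h1
      have : |(m : ℝ)| < 1 := by
        refine h1.trans_lt (by norm_num)
      have : |m| < 1 := by exact_mod_cast this
      exact Int.abs_lt_one_iff.1 this
    simp [hm]
  have hUr : {z : ℂ | |z.re| ≤ 1 / 2 ∧ |z.im| ≤ b} ⊆ U := by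
    rintro z ⟨h1, h2⟩
    by_cases hz : z ∈ LatSet τ
    · right
      rw [hrect z h1 h2 hz]
      exact Metric.mem_ball_self (hr0.trans hr)
    · exact Or.inl hz
  set u : ℂ → ℂ := fun z => (z - 0) ^ N • h z with hu
  have hud : DifferentiableOn ℂ u U := by
    intro z hz
    by_cases h0 : z = 0
    · rw [h0]; exact hN.differentiableAt.differentiableWithinAt
    · have : DifferentiableAt ℂ h z :=
        hd.differentiableAt (hL.isOpen_compl.mem_nhds (hU0 z hz h0))
      exact (((differentiableAt_id.sub_const (0 : ℂ)).pow N).smul this).differentiableWithinAt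
  have hback : ∀ z : ℂ, z ≠ 0 → u z * (z ^ N)⁻¹ = h z := by
    intro z hz
    simp only [hu, sub_zero, smul_eq_mul]
    field_simp
  have main := rect_circle ha hb hr0 hU hUr hUc N u hud
  rw [rectInt_congr ha hb (fun z hz => hback z (rectBd_ne_zero ha hb hz)),
    circleIntegral.integral_congr hr0.le (g := h) (fun z hz => hback z (by
      rintro rfl
      simp at hz; linarith))] at main
  have him : ∀ x : ℝ, ∀ c : ℝ, |c| = b → ((x : ℂ) + (c : ℂ) * I) ∉ LatSet τ := by
    rintro x c hc ⟨m, n, hmn⟩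
    have := congrArg Complex.im hmn
    simp at this
    rw [this, abs_mul, abs_of_pos hτ] at hc
    have h2 : |(n : ℝ)| * 2 = 1 := by
      have : (|(n : ℝ)| * 2 - 1) * τ.im = 0 := by rw [hbdef] at hc; linarith
      rcases mul_eq_zero.1 this with h | h <;> linarith
    have h3 : |n| * 2 = 1 := by exact_mod_cast h2
    omega
  have hzero : rectInt (1 / 2) b h = 0 := by
    have hv : ∀ y ∈ Set.uIcc (-b) b, h (((1 / 2 : ℝ) : ℂ) + y * I) =
        h (((-(1 / 2) : ℝ) : ℂ) + y * I) := by
      intro y hy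
      have hm := rect_side_v hb (a := 1 / 2) (-(1 / 2)) (by norm_num) y hy
      rw [← hp1 _ (hU0 _ (hUr ?_) (rectBd_ne_zero ha hb hm))]
      · congr 1; push_cast; ring
      · rcases hm with h | h
        · exact ⟨h.1.le, h.2⟩
        · exact ⟨h.1, h.2.le⟩
    have hper : Function.Periodic (fun x : ℝ => h (x + (b : ℂ) * I)) 1 := by
      intro x
      have := hp1 _ (him x b (abs_of_pos hb))
      simp only
      rw [← this]
      congr 1; push_cast; ring
    have hhor : (∫ x : ℝ in (-(1 / 2))..(1 / 2), h (x + ((-b : ℝ) : ℂ) * I)) =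
        ∫ x : ℝ in (-(1 / 2))..(1 / 2), h (x + (b : ℂ) * I) := by
      have e : ∀ x : ℝ, h (x + ((-b : ℝ) : ℂ) * I) =
          (fun x : ℝ => h (x + (b : ℂ) * I)) (x + τ.re) := by
        intro x
        rw [← hp2 _ (him x (-b) (by rw [abs_neg, abs_of_pos hb]))]
        simp only
        congr 1
        apply Complex.ext <;> simp [hbdef]
        ring
      simp_rw [e]
      rw [intervalIntegral.integral_comp_add_right (fun x : ℝ => h (x + (b : ℂ) * I))]
      have := hper.intervalIntegral_add_eq (-(1 / 2) + τ.re) (-(1 / 2))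
      convert this using 2 <;> ring
    unfold rectInt
    rw [hhor, intervalIntegral.integral_congr hv]
    ring
  rw [hzero, mul_zero] at main
  exact (mul_eq_zero.1 main.symm).resolve_left (rectInt_inv_ne_zero ha hb)
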